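/- Let T>0, b>0, β>0, N≥1 be given, and let a_1,…,a_N>0 and α_1,…,α_N>0. Suppose φ:(0,T]→[0,∞) is continuous, for every t∈(0,T] the function r ↦ (t−r)^{−1+β}φ(r) is integrable on (0,t), and φ(t) ≤ Σ_{k=1}^N a_k t^{−1+α_k} + b ∫_0^t (t−r)^{−1+β} φ(r) dr for all 0<t≤T. Then there exists a positive constant C = C(b,T,α_1,…,α_N,β), independent of a_1,…,a_N, such that φ(t) ≤ C Σ_{k=1}^N a_k t^{−1+α_k} for all 0<t≤T. -/

import Mathlib

open MeasureTheory Set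

open Filter

theorem eventually_rpow_le_mul_exp {θ η : ℝ} (hθ : 0 < θ) (hη : 0 < η) :
    ∀ᶠ l : ℝ in atTop, ∀ u : ℝ, 0 < u → u ^ θ ≤ η * Real.exp (l * u) := by
  have hc : 0 < η ^ θ⁻¹ := Real.rpow_pos_of_pos hη _
  filter_upwards [eventually_ge_atTop (θ / η ^ θ⁻¹)] with l hl u hu
  have h1 : u ≤ η ^ θ⁻¹ * Real.exp (l * u / θ) := by
    have h2 : u / η ^ θ⁻¹ ≤ l * u / θ := by
      rw [div_le_div_iff₀ hc hθ]
      rw [div_le_iff₀ hc] at hl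
      nlinarith
    have h3 : u / η ^ θ⁻¹ ≤ Real.exp (l * u / θ) := by
      linarith [Real.add_one_le_exp (l * u / θ)]
    rw [div_le_iff₀ hc] at h3
    linarith
  calc u ^ θ ≤ (η ^ θ⁻¹ * Real.exp (l * u / θ)) ^ θ := by gcongr
    _ = η * Real.exp (l * u) := by
      rw [Real.mul_rpow hc.le (Real.exp_pos _).le, ← Real.exp_mul, Real.rpow_inv_rpow hη.le hθ.ne',
        div_mul_cancel₀ _ hθ.ne']

theorem eventually_rpow_mul_exp_neg_le {β η : ℝ} (hβ : 0 < β) (hη : 0 < η) :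
    ∀ᶠ l : ℝ in atTop, ∀ u : ℝ, 0 < u →
      u ^ (-1 + β) * Real.exp (-(l * u)) ≤ η * u ^ (-1 + β / 2) := by
  filter_upwards [eventually_rpow_le_mul_exp (half_pos hβ) hη] with l hl u hu
  have h : u ^ (-1 + β) = u ^ (β / 2) * u ^ (-1 + β / 2) := by
    rw [← Real.rpow_add hu]; ring_nf
  have hp : 0 < u ^ (-1 + β / 2) := Real.rpow_pos_of_pos hu _
  calc u ^ (-1 + β) * Real.exp (-(l * u))
      ≤ (η * Real.exp (l * u) * u ^ (-1 + β / 2)) * Real.exp (-(l * u)) := by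
        rw [h]; gcongr; exact hl u hu
    _ = η * u ^ (-1 + β / 2) * (Real.exp (l * u) * Real.exp (-(l * u))) := by ring
    _ = η * u ^ (-1 + β / 2) := by rw [← Real.exp_add]; simp

theorem intervalIntegrable_one_sub_rpow_mul_rpow {θ α : ℝ} (hθ : 0 < θ) (hα : 0 < α) :
    IntervalIntegrable (fun s : ℝ => (1 - s) ^ (-1 + θ) * s ^ (-1 + α)) volume 0 1 := by
  have h := (Complex.betaIntegral_convergent (u := α) (v := θ) (by simpa) (by simpa)).norm
  refine h.congr_ae ?_
  rw [uIoc_of_le zero_le_one, Filter.EventuallyEq, ← restrict_Ioo_eq_restrict_Ioc,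
    ae_restrict_iff' measurableSet_Ioo]
  refine Eventually.of_forall fun s hs => ?_
  have h1 : 0 < 1 - s := sub_pos.2 hs.2
  have h2 : (1 - (s : ℂ)) = ((1 - s : ℝ) : ℂ) := by push_cast; rfl
  simp only [norm_mul]
  rw [h2, Complex.norm_cpow_eq_rpow_re_of_pos hs.1, Complex.norm_cpow_eq_rpow_re_of_pos h1]
  simp only [Complex.sub_re, Complex.ofReal_re, Complex.one_re]
  rw [mul_comm, sub_eq_neg_add θ, sub_eq_neg_add α]

theorem sub_rpow_mul_rpow_eq {θ α t r : ℝ} (ht : 0 < t) (hr : r ∈ Ioo 0 t) :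
    (t - r) ^ (-1 + θ) * r ^ (-1 + α) =
      t ^ (-2 + θ + α) * ((1 - r / t) ^ (-1 + θ) * (r / t) ^ (-1 + α)) := by
  have h1 : 0 < r / t := div_pos hr.1 ht
  have h2 : 0 < 1 - r / t := sub_pos.2 ((div_lt_one ht).2 hr.2)
  have e1 : t - r = t * (1 - r / t) := by field_simp
  have e2 : r ^ (-1 + α) = t ^ (-1 + α) * (r / t) ^ (-1 + α) := by
    rw [← Real.mul_rpow ht.le h1.le, mul_div_cancel₀ _ ht.ne']
  rw [e1, Real.mul_rpow ht.le h2.le, e2,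
    show -2 + θ + α = (-1 + θ) + (-1 + α) by ring, Real.rpow_add ht (-1 + θ)]
  generalize t ^ (-1 + θ) = x, t ^ (-1 + α) = y
  ring

theorem integrableOn_sub_rpow_mul_rpow {θ α t : ℝ} (hθ : 0 < θ) (hα : 0 < α) (ht : 0 < t) :
    IntegrableOn (fun r : ℝ => (t - r) ^ (-1 + θ) * r ^ (-1 + α)) (Ioo 0 t) := by
  have h := IntervalIntegrable.comp_mul_left (c := t⁻¹)
    (intervalIntegrable_one_sub_rpow_mul_rpow hθ hα)
  rw [zero_div, one_div, inv_inv, intervalIntegrable_iff_integrableOn_Ioo_of_le ht.le] at h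
  refine IntegrableOn.congr_fun (h.const_mul (t ^ (-2 + θ + α))) (fun r hr => ?_) measurableSet_Ioo
  rw [sub_rpow_mul_rpow_eq ht hr]
  simp only [div_eq_inv_mul]

theorem integral_sub_rpow_mul_rpow {θ α t : ℝ} (ht : 0 < t) :
    ∫ r in Ioo 0 t, (t - r) ^ (-1 + θ) * r ^ (-1 + α) =
      t ^ (-1 + θ + α) * ∫ s in Ioo (0 : ℝ) 1, (1 - s) ^ (-1 + θ) * s ^ (-1 + α) := by
  rw [setIntegral_congr_fun measurableSet_Ioo fun r hr => sub_rpow_mul_rpow_eq ht hr,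
    integral_const_mul, ← integral_Ioc_eq_integral_Ioo, ← integral_Ioc_eq_integral_Ioo,
    ← intervalIntegral.integral_of_le ht.le, ← intervalIntegral.integral_of_le zero_le_one,
    intervalIntegral.integral_comp_div
      (fun s : ℝ => (1 - s) ^ (-1 + θ) * s ^ (-1 + α)) ht.ne', zero_div, div_self ht.ne',
    smul_eq_mul, ← mul_assoc, show -1 + θ + α = (-2 + θ + α) + 1 by ring, Real.rpow_add_one ht.ne']

/-- A Volterra inequality whose kernel has mass less than one has only the trivial solution. -/
theorem eq_zero_of_le_lintegral_volterra {T : ℝ} {k g : ℝ → ENNReal} (hk : Measurable k)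
    (hg : AEMeasurable g (volume.restrict (Ioo 0 T)))
    (hk1 : ∫⁻ u in Ioo 0 T, k u < 1) (hgfin : ∫⁻ t in Ioo 0 T, g t ≠ ⊤)
    (hle : ∀ t ∈ Ioc 0 T, g t ≤ ∫⁻ r in Ioo 0 t, k (t - r) * g r) :
    ∀ t ∈ Ioc 0 T, g t = 0 := by
  set k' := (Ioo 0 T).indicator k with hk'
  set g' := (Ioo 0 T).indicator g with hg'
  have hk'm : Measurable k' := hk.indicator measurableSet_Ioo
  have hg'm : AEMeasurable g' := (aemeasurable_indicator_iff measurableSet_Ioo).2 hg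
  have hle' : ∀ t, g' t ≤ ∫⁻ r, k' (t - r) * g' r := by
    intro t
    by_cases ht : t ∈ Ioo 0 T
    · rw [hg', indicator_of_mem ht]
      refine (hle t (Ioo_subset_Ioc_self ht)).trans ?_
      rw [← lintegral_indicator measurableSet_Ioo]
      refine lintegral_mono fun r => ?_
      by_cases hr : r ∈ Ioo 0 t
      · rw [indicator_of_mem hr, hk', indicator_of_mem (by grind), indicator_of_mem (by grind)]
      · rw [indicator_of_notMem hr]; exact zero_le
    · rw [hg', indicator_of_notMem ht]; exact zero_le
  have hmul : ∫⁻ t, g' t ≤ (∫⁻ u, k' u) * ∫⁻ r, g' r := by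
    calc ∫⁻ t, g' t ≤ ∫⁻ t, ∫⁻ r, k' (t - r) * g' r := lintegral_mono hle'
      _ = ∫⁻ r, ∫⁻ t, k' (t - r) * g' r := by
        apply lintegral_lintegral_swap
        exact ((hk'm.comp (measurable_fst.sub measurable_snd)).aemeasurable).mul hg'm.comp_snd
      _ = ∫⁻ r, (∫⁻ u, k' u) * g' r := by
        refine lintegral_congr fun r => ?_
        rw [lintegral_mul_const _ (by fun_prop), lintegral_sub_right_eq_self]
      _ = _ := lintegral_const_mul'' _ hg'm
  rw [hk', hg', lintegral_indicator measurableSet_Ioo, lintegral_indicator measurableSet_Ioo]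
    at hmul
  have h0 : ∫⁻ t in Ioo 0 T, g t = 0 := by
    by_contra h
    have := ENNReal.mul_lt_mul_left h hgfin hk1
    rw [one_mul] at this
    exact absurd hmul (not_le.2 (by simpa [mul_comm] using this))
  rw [lintegral_eq_zero_iff' hg] at h0
  intro t ht
  refine le_antisymm ((hle t ht).trans_eq ?_) zero_le
  refine lintegral_eq_zero_of_ae_eq_zero ?_
  filter_upwards [ae_restrict_of_ae_restrict_of_subset (Ioo_subset_Ioo_right ht.2) h0] with r hr
  simp [hr]

theorem integrableOn_sub_rpow_mul_exp_mul_rpow {β α t : ℝ} (l : ℝ) (hβ : 0 < β) (hα : 0 < α)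
    (ht : 0 < t) :
    IntegrableOn (fun r : ℝ => (t - r) ^ (-1 + β) * (Real.exp (l * r) * r ^ (-1 + α)))
      (Ioo 0 t) := by
  have h := (integrableOn_sub_rpow_mul_rpow hβ hα ht).continuousOn_mul_of_subset
    (g := fun r => Real.exp (l * r)) (K := Icc 0 t) (by fun_prop) isCompact_Icc
    measurableSet_Ioo Ioo_subset_Icc_self
  exact h.congr_fun (fun r _ => by simp only; ring) measurableSet_Ioo

theorem eventually_integral_sub_rpow_mul_exp_le {β α η : ℝ} (T : ℝ) (hβ : 0 < β) (hα : 0 < α)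
    (hη : 0 < η) :
    ∀ᶠ l : ℝ in atTop, ∀ t ∈ Ioc 0 T,
      ∫ r in Ioo 0 t, (t - r) ^ (-1 + β) * (Real.exp (l * r) * r ^ (-1 + α)) ≤
        η * (Real.exp (l * t) * t ^ (-1 + α)) := by
  set B := ∫ s in Ioo (0 : ℝ) 1, (1 - s) ^ (-1 + β / 2) * s ^ (-1 + α) with hB
  have hB0 : 0 ≤ B := setIntegral_nonneg measurableSet_Ioo fun s hs =>
    mul_nonneg (Real.rpow_nonneg (sub_nonneg.2 hs.2.le) _) (Real.rpow_nonneg hs.1.le _)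
  rcases le_or_gt T 0 with hT | hT
  · exact Eventually.of_forall fun l t ht => absurd (ht.1.trans_le ht.2) hT.not_gt
  have hD : 0 ≤ T ^ (β / 2) * B := mul_nonneg (Real.rpow_nonneg hT.le _) hB0
  filter_upwards [eventually_rpow_mul_exp_neg_le hβ
    (div_pos hη (by linarith : 0 < T ^ (β / 2) * B + 1))] with l hl t ht
  set ε := η / (T ^ (β / 2) * B + 1) with hε
  have hε0 : 0 < ε := by positivity
  calc ∫ r in Ioo 0 t, (t - r) ^ (-1 + β) * (Real.exp (l * r) * r ^ (-1 + α))
      ≤ ∫ r in Ioo 0 t, ε * Real.exp (l * t) * ((t - r) ^ (-1 + β / 2) * r ^ (-1 + α)) := by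
        refine setIntegral_mono_on (integrableOn_sub_rpow_mul_exp_mul_rpow l hβ hα ht.1)
          ((integrableOn_sub_rpow_mul_rpow (half_pos hβ) hα ht.1).const_mul _)
          measurableSet_Ioo fun r hr => ?_
        have he : Real.exp (l * r) = Real.exp (-(l * (t - r))) * Real.exp (l * t) := by
          rw [← Real.exp_add]; ring_nf
        have hr' : 0 ≤ r ^ (-1 + α) := Real.rpow_nonneg hr.1.le _
        calc (t - r) ^ (-1 + β) * (Real.exp (l * r) * r ^ (-1 + α))
            = ((t - r) ^ (-1 + β) * Real.exp (-(l * (t - r)))) *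
                (Real.exp (l * t) * r ^ (-1 + α)) := by rw [he]; ring
          _ ≤ (ε * (t - r) ^ (-1 + β / 2)) * (Real.exp (l * t) * r ^ (-1 + α)) := by
            exact mul_le_mul_of_nonneg_right (hl _ (sub_pos.2 hr.2)) (by positivity)
          _ = _ := by ring
    _ = ε * (t ^ (β / 2) * B) * (Real.exp (l * t) * t ^ (-1 + α)) := by
        rw [integral_const_mul, integral_sub_rpow_mul_rpow ht.1,
          show -1 + β / 2 + α = β / 2 + (-1 + α) by ring, Real.rpow_add ht.1]
        ring
    _ ≤ η * (Real.exp (l * t) * t ^ (-1 + α)) := by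
        have : 0 ≤ t ^ (-1 + α) := Real.rpow_nonneg ht.1.le _
        gcongr
        calc ε * (t ^ (β / 2) * B) ≤ ε * (T ^ (β / 2) * B + 1) := by
              have : t ^ (β / 2) ≤ T ^ (β / 2) :=
                Real.rpow_le_rpow ht.1.le ht.2 (half_pos hβ).le
              gcongr
              nlinarith
          _ = η := div_mul_cancel₀ _ (by linarith)

theorem eventually_lintegral_rpow_mul_exp_neg_lt_one {β b T : ℝ} (hβ : 0 < β) (hb : 0 < b)
    (hT : 0 < T) :
    ∀ᶠ l : ℝ in atTop,
      ∫⁻ u in Ioo 0 T, ENNReal.ofReal (b * (u ^ (-1 + β) * Real.exp (-(l * u)))) < 1 := by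
  set M := ∫ u in Ioo 0 T, u ^ (-1 + β / 2) with hM
  have hM0 : 0 ≤ M := setIntegral_nonneg measurableSet_Ioo fun s hs => Real.rpow_nonneg hs.1.le _
  have hint : IntegrableOn (fun u : ℝ => u ^ (-1 + β / 2)) (Ioo 0 T) :=
    (intervalIntegrable_iff_integrableOn_Ioo_of_le hT.le).1
      (intervalIntegral.intervalIntegrable_rpow' (by linarith))
  have hd : 0 < b * (M + 1) := by positivity
  filter_upwards [eventually_rpow_mul_exp_neg_le hβ (inv_pos.2 hd)] with l hl
  calc ∫⁻ u in Ioo 0 T, ENNReal.ofReal (b * (u ^ (-1 + β) * Real.exp (-(l * u))))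
      ≤ ∫⁻ u in Ioo 0 T, ENNReal.ofReal (b * (b * (M + 1))⁻¹ * u ^ (-1 + β / 2)) := by
        refine setLIntegral_mono' measurableSet_Ioo fun u hu => ENNReal.ofReal_le_ofReal ?_
        rw [mul_assoc]
        exact mul_le_mul_of_nonneg_left (hl u hu.1) hb.le
    _ = ENNReal.ofReal (∫ u in Ioo 0 T, b * (b * (M + 1))⁻¹ * u ^ (-1 + β / 2)) := by
        refine (ofReal_integral_eq_lintegral_ofReal (hint.const_mul _) ?_).symm
        refine ae_restrict_of_forall_mem measurableSet_Ioo fun u hu => ?_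
        have := Real.rpow_nonneg hu.1.le (-1 + β / 2)
        simp only [Pi.zero_apply]
        positivity
    _ < 1 := by
        rw [integral_const_mul, ← hM, ENNReal.ofReal_lt_one, mul_inv, mul_inv_cancel_left₀ hb.ne',
          inv_mul_lt_iff₀ (by linarith)]
        linarith

theorem ofReal_integral_le_lintegral_ofReal {X : Type*} [MeasurableSpace X] {μ : Measure X}
    {f : X → ℝ} (hf : Integrable f μ) :
    ENNReal.ofReal (∫ x, f x ∂μ) ≤ ∫⁻ x, ENNReal.ofReal (f x) ∂μ := by
  rw [integral_eq_lintegral_pos_part_sub_lintegral_neg_part hf]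
  exact (ENNReal.ofReal_le_ofReal (sub_le_self _ ENNReal.toReal_nonneg)).trans
    ENNReal.ofReal_toReal_le

theorem integrableOn_Ioc_of_integrableOn_sub_rpow_mul {p T : ℝ} {φ : ℝ → ℝ} (hT : 0 < T)
    (hφ : ContinuousOn φ (Ioc 0 T))
    (hint : IntegrableOn (fun r => (T - r) ^ p * φ r) (Ioo 0 T)) :
    IntegrableOn φ (Ioc 0 T) := by
  have hpos : ∀ r ∈ Icc 0 (T / 2), 0 < T - r := fun r hr => by linarith [hr.2]
  have h1 : IntegrableOn φ (Ioc 0 (T / 2)) := by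
    have h := (hint.mono_set (s := Ioc 0 (T / 2)) fun r hr =>
      ⟨hr.1, by linarith [hr.2]⟩).continuousOn_mul_of_subset
      (g := fun r => (T - r) ^ (-p)) (K := Icc 0 (T / 2))
      (ContinuousOn.rpow_const (by fun_prop) fun r hr => Or.inl (hpos r hr).ne') isCompact_Icc
      measurableSet_Ioc Ioc_subset_Icc_self
    refine h.congr_fun (fun r hr => ?_) measurableSet_Ioc
    have := hpos r (Ioc_subset_Icc_self hr)
    simp only
    rw [← mul_assoc, ← Real.rpow_add this, neg_add_cancel, Real.rpow_zero, one_mul]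
  have h2 : IntegrableOn φ (Icc (T / 2) T) :=
    (hφ.mono fun r hr => ⟨by linarith [hr.1], hr.2⟩).integrableOn_Icc
  refine (h1.union h2).mono_set fun r hr => ?_
  rcases le_total r (T / 2) with h | h
  · exact Or.inl ⟨hr.1, h⟩
  · exact Or.inr ⟨h, hr.2⟩

/-- Comparison principle: a sub-solution of a Volterra inequality with kernel
`b * (t - r) ^ (-1 + β)` which is integrable from above is nonpositive. -/
theorem nonpos_of_le_integral_sub_rpow_mul {b β T : ℝ} {ψ : ℝ → ℝ} (hb : 0 < b) (hβ : 0 < β)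
    (hT : 0 < T) (hψ : AEMeasurable ψ (volume.restrict (Ioo 0 T)))
    (hfin : ∫⁻ t in Ioo 0 T, ENNReal.ofReal (ψ t) ≠ ⊤)
    (hint : ∀ t ∈ Ioc 0 T, IntegrableOn (fun r => (t - r) ^ (-1 + β) * ψ r) (Ioo 0 t))
    (hle : ∀ t ∈ Ioc 0 T, ψ t ≤ b * ∫ r in Ioo 0 t, (t - r) ^ (-1 + β) * ψ r) :
    ∀ t ∈ Ioc 0 T, ψ t ≤ 0 := by
  obtain ⟨l, hl, hl0⟩ := ((eventually_lintegral_rpow_mul_exp_neg_lt_one hβ hb hT).and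
    (eventually_ge_atTop 0)).exists
  have key := eq_zero_of_le_lintegral_volterra (T := T)
    (k := fun u => ENNReal.ofReal (b * (u ^ (-1 + β) * Real.exp (-(l * u)))))
    (g := fun t => ENNReal.ofReal (Real.exp (-(l * t)) * ψ t))
    (by fun_prop) (by fun_prop) hl ?_ ?_
  · intro t ht
    have h := ENNReal.ofReal_eq_zero.1 (key t ht)
    exact nonpos_of_mul_nonpos_right h (Real.exp_pos _)
  · refine ne_top_of_le_ne_top hfin (setLIntegral_mono' measurableSet_Ioo fun t ht => ?_)
    rw [ENNReal.ofReal_mul (Real.exp_pos _).le]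
    refine mul_le_of_le_one_left zero_le (ENNReal.ofReal_le_one.2 (Real.exp_le_one_iff.2 ?_))
    have := mul_nonneg hl0 ht.1.le
    linarith
  · intro t ht
    calc ENNReal.ofReal (Real.exp (-(l * t)) * ψ t)
        ≤ ENNReal.ofReal (∫ r in Ioo 0 t,
            Real.exp (-(l * t)) * b * ((t - r) ^ (-1 + β) * ψ r)) := by
          rw [integral_const_mul, mul_assoc]
          exact ENNReal.ofReal_le_ofReal
            (mul_le_mul_of_nonneg_left (hle t ht) (Real.exp_pos _).le)
      _ ≤ ∫⁻ r in Ioo 0 t, ENNReal.ofReal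
            (Real.exp (-(l * t)) * b * ((t - r) ^ (-1 + β) * ψ r)) :=
          ofReal_integral_le_lintegral_ofReal ((hint t ht).const_mul _)
      _ = _ := by
          refine setLIntegral_congr_fun measurableSet_Ioo fun r hr => ?_
          have := Real.rpow_nonneg (sub_pos.2 hr.2).le (-1 + β)
          rw [← ENNReal.ofReal_mul (by positivity)]
          have he : Real.exp (-(l * t)) = Real.exp (-(l * (t - r))) * Real.exp (-(l * r)) := by
            rw [← Real.exp_add]; ring_nf
          rw [he]
          ring_nf

/-- Weakly singular Grönwall inequality (Lemma 1 of the paper): if a nonnegative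
continuous `φ` on `(0,T]` satisfies
`φ t ≤ ∑ k, a k * t ^ (-1 + α k) + b * ∫_0^t (t-r)^(-1+β) φ r dr`,
then `φ t ≤ C * ∑ k, a k * t ^ (-1 + α k)` with `C = C(b,T,α,β)` independent of the `a k`. -/
theorem gronwall_weakly_singular
    (T b β : ℝ) (hT : 0 < T) (hb : 0 < b) (hβ : 0 < β)
    (N : ℕ) (hN : 1 ≤ N) (α : Fin N → ℝ) (hα : ∀ k, 0 < α k) :
    ∃ C : ℝ, 0 < C ∧
      ∀ (a : Fin N → ℝ) (φ : ℝ → ℝ),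
        (∀ k, 0 < a k) →
        ContinuousOn φ (Ioc 0 T) →
        (∀ t ∈ Ioc (0:ℝ) T, 0 ≤ φ t) →
        (∀ t ∈ Ioc (0:ℝ) T,
          IntegrableOn (fun r => (t - r) ^ (-1 + β) * φ r) (Ioo 0 t)) →
        (∀ t ∈ Ioc (0:ℝ) T,
          φ t ≤ (∑ k, a k * t ^ (-1 + α k)) +
            b * ∫ r in Ioo (0:ℝ) t, (t - r) ^ (-1 + β) * φ r) →
        ∀ t ∈ Ioc (0:ℝ) T, φ t ≤ C * ∑ k, a k * t ^ (-1 + α k) := by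
  
  have hη : 0 < (2 * b)⁻¹ := by positivity
  obtain ⟨l, hl, hl0⟩ := ((eventually_all.2 fun k =>
    eventually_integral_sub_rpow_mul_exp_le T hβ (hα k) hη).and (eventually_ge_atTop 0)).exists
  refine ⟨2 * Real.exp (l * T), by positivity, fun a φ ha hφc hφ0 hφi hφ => ?_⟩
  set f : ℝ → ℝ := fun t => ∑ k, a k * t ^ (-1 + α k) with hf
  set w : ℝ → ℝ := fun t => ∑ k, 2 * a k * (Real.exp (l * t) * t ^ (-1 + α k)) with hw
  have hwf : ∀ t, w t = 2 * Real.exp (l * t) * f t := fun t => by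
    simp only [hw, hf, Finset.mul_sum]
    exact Finset.sum_congr rfl fun k _ => by ring
  have hf0 : ∀ t ∈ Ioc 0 T, 0 ≤ f t := fun t ht => Finset.sum_nonneg fun k _ =>
    mul_nonneg (ha k).le (Real.rpow_nonneg ht.1.le _)
  have hkw : ∀ t r : ℝ, (t - r) ^ (-1 + β) * w r =
      ∑ k, 2 * a k * ((t - r) ^ (-1 + β) * (Real.exp (l * r) * r ^ (-1 + α k))) := fun t r => by
    simp only [hw, Finset.mul_sum]
    exact Finset.sum_congr rfl fun k _ => by ring
  have hwi' : ∀ t ∈ Ioc 0 T, ∀ k, IntegrableOn (fun r => 2 * a k *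
      ((t - r) ^ (-1 + β) * (Real.exp (l * r) * r ^ (-1 + α k)))) (Ioo 0 t) := fun t ht k =>
    (integrableOn_sub_rpow_mul_exp_mul_rpow l hβ (hα k) ht.1).const_mul _
  have hwi : ∀ t ∈ Ioc 0 T, IntegrableOn (fun r => (t - r) ^ (-1 + β) * w r) (Ioo 0 t) := by
    intro t ht
    simp only [hkw]
    exact integrable_finsetSum _ fun k _ => hwi' t ht k
  have hwle : ∀ t ∈ Ioc 0 T,
      b * ∫ r in Ioo 0 t, (t - r) ^ (-1 + β) * w r ≤ Real.exp (l * t) * f t := by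
    intro t ht
    simp only [hkw]
    rw [integral_finsetSum _ fun k _ => hwi' t ht k, hf, Finset.mul_sum, Finset.mul_sum]
    refine Finset.sum_le_sum fun k _ => ?_
    rw [integral_const_mul]
    have hak := ha k
    calc b * (2 * a k * _) ≤ b * (2 * a k *
          ((2 * b)⁻¹ * (Real.exp (l * t) * t ^ (-1 + α k)))) := by
          gcongr; exact hl k t ht
      _ = _ := by field_simp
  have hψ := nonpos_of_le_integral_sub_rpow_mul (ψ := fun t => φ t - w t) hb hβ hT ?_ ?_ ?_ ?_
  · intro t ht
    have h1 := hψ t ht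
    have h2 := hf0 t ht
    have h3 : Real.exp (l * t) ≤ Real.exp (l * T) :=
      Real.exp_le_exp.2 (mul_le_mul_of_nonneg_left ht.2 hl0)
    calc φ t ≤ 2 * Real.exp (l * t) * f t := by rw [← hwf]; linarith
      _ ≤ 2 * Real.exp (l * T) * f t := by gcongr
  · refine AEMeasurable.sub ?_ (by fun_prop)
    exact (hφc.mono Ioo_subset_Ioc_self).aemeasurable measurableSet_Ioo
  · have hφint := (integrableOn_Ioc_of_integrableOn_sub_rpow_mul hT hφc
      (hφi T ⟨hT, le_rfl⟩)).mono_set Ioo_subset_Ioc_self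
    refine ne_top_of_le_ne_top hφint.lintegral_lt_top.ne
      (setLIntegral_mono' measurableSet_Ioo fun t ht => ENNReal.ofReal_le_ofReal ?_)
    have := hf0 t (Ioo_subset_Ioc_self ht)
    rw [hwf]
    exact sub_le_self _ (by positivity)
  · intro t ht
    simp only [mul_sub]
    exact (hφi t ht).sub (hwi t ht)
  · intro t ht
    simp only [mul_sub]
    rw [integral_sub (hφi t ht) (hwi t ht), mul_sub]
    have h1 := hφ t ht
    have h2 := hwle t ht
    have h3 : f t ≤ Real.exp (l * t) * f t :=
      le_mul_of_one_le_left (hf0 t ht) (Real.one_le_exp (mul_nonneg hl0 ht.1.le))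
    have h4 := hwf t
    change φ t ≤ f t + _ at h1
    linarith
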